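/- arXiv:2602.04675 — 7 statements merged into one kernel-verified Lean document; each statement's English description precedes it below -/
import Mathlib

section
/- Let S be a finite nonempty set, let r : S → (0, ∞) and c : S → ℝ. Then the infimum over all u : S → (0, ∞) of the quantity ∑_{y ∈ S} [ u(y)·log(u(y)/r(y)) − u(y) + r(y) + c(y)·u(y) ] equals ∑_{y ∈ S} r(y)·(1 − e^{−c(y)}), and this infimum is attained at the unique minimizer u⋆(y) = r(y)·e^{−c(y)}. -/
lemma aux_eq (u r c : ℝ) (hu : 0 < u) (hr : 0 < r) :
    (u * Real.log (u / r) - u + r + c * u) - r * (1 - Real.exp (-c))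
      = u * ((r * Real.exp (-c) / u) - 1 - Real.log (r * Real.exp (-c) / u)) := by
  have he := Real.exp_pos (-c)
  rw [Real.log_div hu.ne' hr.ne', Real.log_div (by positivity) hu.ne',
    Real.log_mul hr.ne' he.ne', Real.log_exp]
  field_simp
  ring

lemma aux_le (u r c : ℝ) (hu : 0 < u) (hr : 0 < r) :
    r * (1 - Real.exp (-c)) ≤ u * Real.log (u / r) - u + r + c * u := by
  have h := aux_eq u r c hu hr
  have he := Real.exp_pos (-c)
  have h1 := Real.log_le_sub_one_of_pos (show 0 < r * Real.exp (-c) / u by positivity)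
  have h2 := mul_nonneg hu.le (sub_nonneg.2 h1)
  linarith

lemma aux_uniq (u r c : ℝ) (hu : 0 < u) (hr : 0 < r)
    (h0 : r * (1 - Real.exp (-c)) = u * Real.log (u / r) - u + r + c * u) :
    u = r * Real.exp (-c) := by
  have h := aux_eq u r c hu hr
  have he := Real.exp_pos (-c)
  by_contra hne
  have hz : r * Real.exp (-c) / u ≠ 1 := by
    intro hz
    rw [div_eq_one_iff_eq hu.ne'] at hz
    exact hne hz.symm
  have h1 := Real.log_lt_sub_one_of_pos (show 0 < r * Real.exp (-c) / u by positivity) hz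
  have h2 := mul_pos hu (sub_pos.2 h1)
  linarith

/-- For a finite nonempty set `S`, `r : S → (0,∞)`, `c : S → ℝ`, the infimum over
`u : S → (0,∞)` of `∑ y, (u y · log (u y / r y) − u y + r y + c y · u y)` equals
`∑ y, r y · (1 − exp (−c y))`, is attained, and the minimizer
`u⋆ y = r y · exp (−c y)` is unique. -/
theorem stmt1 {S : Type*} [Fintype S] [Nonempty S]
    (r c : S → ℝ) (hr : ∀ y, 0 < r y) :
    IsLeast {v : ℝ | ∃ u : S → ℝ, (∀ y, 0 < u y) ∧
        v = ∑ y, (u y * Real.log (u y / r y) - u y + r y + c y * u y)}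
      (∑ y, r y * (1 - Real.exp (-(c y)))) ∧
    (∀ u : S → ℝ, (∀ y, 0 < u y) →
      (∑ y, (u y * Real.log (u y / r y) - u y + r y + c y * u y))
        = ∑ y, r y * (1 - Real.exp (-(c y))) →
      u = fun y => r y * Real.exp (-(c y))) := by
  refine ⟨⟨⟨fun y => r y * Real.exp (-(c y)), fun y => mul_pos (hr y) (Real.exp_pos _), ?_⟩, ?_⟩, ?_⟩
  · refine Finset.sum_congr rfl fun y _ => ?_
    have h : r y * Real.exp (-(c y)) / r y = Real.exp (-(c y)) :=
      mul_div_cancel_left₀ _ (hr y).ne'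
    simp only [h, Real.log_exp]
    ring
  · rintro v ⟨u, hu, rfl⟩
    exact Finset.sum_le_sum fun y _ => aux_le _ _ _ (hu y) (hr y)
  · intro u hu h
    have key := (Finset.sum_eq_sum_iff_of_le
      (fun y _ => aux_le (u y) (r y) (c y) (hu y) (hr y))).1 h.symm
    funext y
    exact aux_uniq _ _ _ (hu y) (hr y) (key y (Finset.mem_univ y))
end

section
/- Let 𝒳 be a finite nonempty set, fix t and x ∈ 𝒳, let r : 𝒳 × 𝒳 → ℝ satisfy r(y,x) > 0 for all y ≠ x and the diagonal convention r(x,x) = −∑_{y ≠ x} r(y,x), let f, a ∈ ℝ (a playing the role of ∂_t V_t(x)) and V : 𝒳 → ℝ. Then the equation a = ∑_{y ∈ 𝒳} r(y,x)·exp(V(x) − V(y)) − f holds if and only if inf over all u : {y ∈ 𝒳 : y ≠ x} → (0, ∞) of { a + ∑_{y ≠ x} [ (V(y) − V(x))·u(y) + u(y)·log(u(y)/r(y,x)) − u(y) + r(y,x) ] } + f = 0. -/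
/-- The discrete HJB equation `a = ∑ y, r(y,x)·exp(V x − V y) − f` holds iff the
pointwise Bellman infimum of the KL-regularized running cost vanishes. -/
theorem stmt2 {𝒳 : Type*} [Fintype 𝒳] [DecidableEq 𝒳] [Nonempty 𝒳]
    (x : 𝒳) (r : 𝒳 → 𝒳 → ℝ) (hr : ∀ y, y ≠ x → 0 < r y x)
    (hdiag : r x x = -∑ y ∈ Finset.univ.erase x, r y x)
    (f a : ℝ) (V : 𝒳 → ℝ) :
    (a = ∑ y, r y x * Real.exp (V x - V y) - f) ↔
    sInf {z : ℝ | ∃ u : 𝒳 → ℝ, (∀ y, y ≠ x → 0 < u y) ∧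
        z = a + ∑ y ∈ Finset.univ.erase x,
          ((V y - V x) * u y + u y * Real.log (u y / r y x) - u y + r y x)} + f = 0 := by
  have hlog : ∀ y, y ≠ x → ∀ u : ℝ, 0 < u →
      r y x - r y x * Real.exp (V x - V y) ≤
        (V y - V x) * u + u * Real.log (u / r y x) - u + r y x := by
    intro y hy u hu
    have hry := hr y hy
    have hw : 0 < r y x * Real.exp (V x - V y) / u := by positivity
    have h1 := Real.log_le_sub_one_of_pos hw
    rw [Real.log_div (by positivity) hu.ne', Real.log_mul hry.ne' (Real.exp_pos _).ne',
      Real.log_exp] at h1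
    rw [Real.log_div hu.ne' hry.ne']
    have h2 := mul_le_mul_of_nonneg_left h1 hu.le
    have h3 : u * (r y x * Real.exp (V x - V y) / u - 1)
        = r y x * Real.exp (V x - V y) - u := by
      field_simp
    rw [h3] at h2
    linarith
  have hS : ∑ y, r y x * Real.exp (V x - V y)
      = -∑ y ∈ Finset.univ.erase x, (r y x - r y x * Real.exp (V x - V y)) := by
    rw [← Finset.add_sum_erase _ _ (Finset.mem_univ x), Finset.sum_sub_distrib, hdiag]
    simp
  have hleast : IsLeast {z : ℝ | ∃ u : 𝒳 → ℝ, (∀ y, y ≠ x → 0 < u y) ∧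
        z = a + ∑ y ∈ Finset.univ.erase x,
          ((V y - V x) * u y + u y * Real.log (u y / r y x) - u y + r y x)}
      (a - ∑ y, r y x * Real.exp (V x - V y)) := by
    constructor
    · refine ⟨fun y => r y x * Real.exp (V x - V y),
        fun y hy => mul_pos (hr y hy) (Real.exp_pos _), ?_⟩
      rw [hS, sub_neg_eq_add]
      congr 1
      refine Finset.sum_congr rfl fun y hy => ?_
      have hry := hr y (Finset.ne_of_mem_erase hy)
      rw [mul_div_cancel_left₀ _ hry.ne', Real.log_exp]
      ring
    · rintro z ⟨u, hu, rfl⟩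
      rw [hS, sub_neg_eq_add]
      have h := Finset.sum_le_sum fun y (hy : y ∈ Finset.univ.erase x) =>
        hlog y (Finset.ne_of_mem_erase hy) (u y) (hu y (Finset.ne_of_mem_erase hy))
      linarith
  rw [hleast.csInf_eq]
  constructor <;> intro h <;> linarith
end

section
/- Let 𝒳 be a finite nonempty set, let r : [0,1] × 𝒳 × 𝒳 → ℝ satisfy the diagonal convention r_t(x,x) = −∑_{y ≠ x} r_t(y,x) for all t and x, and let f : [0,1] × 𝒳 → ℝ. Let V : [0,1] × 𝒳 → ℝ be differentiable in t with ∂_t V_t(x) = ∑_{y ∈ 𝒳} r_t(y,x)·exp(V_t(x) − V_t(y)) − f_t(x) for all t, x. Define the controlled rates u_t(y,x) := r_t(y,x)·exp(V_t(x) − V_t(y)) for y ≠ x, and let p : [0,1] × 𝒳 → ℝ be differentiable in t and satisfy the continuity equation ∂_t p_t(x) = ∑_{y ≠ x} u_t(x,y)·p_t(y) − (∑_{y ≠ x} u_t(y,x))·p_t(x) for all t, x. Define φ_t(x) := exp(−V_t(x)) and φ̂_t(x) := p_t(x)·exp(V_t(x)). Then for all t ∈ [0,1] and x ∈ 𝒳,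 ∂_t φ̂_t(x) = ∑_{y ∈ 𝒳} r_t(x,y)·φ̂_t(y) − f_t(x)·φ̂_t(x). -/
/-- Backward-potential equation of the Hopf–Cole transform on a graph:
if `V` solves the discrete HJB equation and `p` solves the continuity equation
with controlled rates `u t y x = r t y x · exp (V t x − V t y)` (for `y ≠ x`),
then `φ̂ t x := p t x · exp (V t x)` satisfies
`∂ₜ φ̂ t x = ∑ y, r t x y · φ̂ t y − f t x · φ̂ t x`. -/
theorem stmt4 {𝒳 : Type*} [Fintype 𝒳] [DecidableEq 𝒳] [Nonempty 𝒳]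
    (r : ℝ → 𝒳 → 𝒳 → ℝ) (f : ℝ → 𝒳 → ℝ) (V p : ℝ → 𝒳 → ℝ)
    (hdiag : ∀ t x, r t x x = -∑ y ∈ Finset.univ.erase x, r t y x)
    (hV : ∀ x, ∀ t ∈ Set.Icc (0:ℝ) 1,
      HasDerivAt (fun s => V s x)
        (∑ y, r t y x * Real.exp (V t x - V t y) - f t x) t)
    (u : ℝ → 𝒳 → 𝒳 → ℝ)
    (hu : ∀ t, ∀ y x, y ≠ x → u t y x = r t y x * Real.exp (V t x - V t y))
    (hp : ∀ x, ∀ t ∈ Set.Icc (0:ℝ) 1,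
      HasDerivAt (fun s => p s x)
        (∑ y ∈ Finset.univ.erase x, u t x y * p t y
          - (∑ y ∈ Finset.univ.erase x, u t y x) * p t x) t) :
    ∀ x, ∀ t ∈ Set.Icc (0:ℝ) 1,
      HasDerivAt (fun s => p s x * Real.exp (V s x))
        (∑ y, r t x y * (p t y * Real.exp (V t y))
          - f t x * (p t x * Real.exp (V t x))) t := by
  intro x t ht
  have h := (hp x t ht).mul (hV x t ht).exp
  refine h.congr_deriv ?_
  have hB : ∑ y ∈ Finset.univ.erase x, u t y x
      = ∑ y ∈ Finset.univ.erase x, r t y x * Real.exp (V t x - V t y) :=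
    Finset.sum_congr rfl fun y hy => hu t y x (Finset.ne_of_mem_erase hy)
  have hA : (∑ y ∈ Finset.univ.erase x, u t x y * p t y) * Real.exp (V t x)
      = ∑ y ∈ Finset.univ.erase x, r t x y * (p t y * Real.exp (V t y)) := by
    rw [Finset.sum_mul]
    refine Finset.sum_congr rfl fun y hy => ?_
    rw [hu t x y (Finset.ne_of_mem_erase hy).symm]
    have he : Real.exp (V t y - V t x) * Real.exp (V t x) = Real.exp (V t y) := by
      rw [← Real.exp_add, sub_add_cancel]
    rw [← he]
    ring
  have h1 := Finset.add_sum_erase Finset.univ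
    (fun y => r t y x * Real.exp (V t x - V t y)) (Finset.mem_univ x)
  have h2 := Finset.add_sum_erase Finset.univ
    (fun y => r t x y * (p t y * Real.exp (V t y))) (Finset.mem_univ x)
  simp only [sub_self, Real.exp_zero, mul_one] at h1
  rw [← h1, ← h2, ← hA, hB]
  ring
end

section
/- Let 𝒳 be a finite nonempty set, let r : [0,1] × 𝒳 × 𝒳 → ℝ and f : [0,1] × 𝒳 → ℝ. Let φ, φ̂ : [0,1] × 𝒳 → ℝ be differentiable in t with φ_t(x) > 0 for all t, x, and suppose ∂_t φ_t(x) = −∑_{y ∈ 𝒳} r_t(y,x)·φ_t(y) + f_t(x)·φ_t(x) and ∂_t φ̂_t(x) = ∑_{y ∈ 𝒳} r_t(x,y)·φ̂_t(y) − f_t(x)·φ̂_t(x) for all t, x. Define p_t(x) := φ_t(x)·φ̂_t(x) and u_t(y,x) := r_t(y,x)·φ_t(y)/φ_t(x) for y ≠ x. Then for all t ∈ [0,1] and x ∈ 𝒳, ∂_t p_t(x) = ∑_{y ≠ x} u_t(x,y)·p_t(y) − (∑_{y ≠ x} u_t(y,x))·p_t(x). -/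
/-- If `(φ, φ̂)` solve the Schrödinger system on a graph, then `p = φ·φ̂` solves the
continuity equation with the optimal controlled rates
`u t y x = r t y x · φ t y / φ t x` (for `y ≠ x`). -/
theorem stmt5 {𝒳 : Type*} [Fintype 𝒳] [DecidableEq 𝒳] [Nonempty 𝒳]
    (r : ℝ → 𝒳 → 𝒳 → ℝ) (f : ℝ → 𝒳 → ℝ) (φ φh : ℝ → 𝒳 → ℝ)
    (hpos : ∀ t ∈ Set.Icc (0:ℝ) 1, ∀ x, 0 < φ t x)
    (hφ : ∀ x, ∀ t ∈ Set.Icc (0:ℝ) 1,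
      HasDerivAt (fun s => φ s x)
        (-∑ y, r t y x * φ t y + f t x * φ t x) t)
    (hφh : ∀ x, ∀ t ∈ Set.Icc (0:ℝ) 1,
      HasDerivAt (fun s => φh s x)
        (∑ y, r t x y * φh t y - f t x * φh t x) t)
    (p : ℝ → 𝒳 → ℝ) (hpdef : ∀ t x, p t x = φ t x * φh t x)
    (u : ℝ → 𝒳 → 𝒳 → ℝ)
    (hu : ∀ t, ∀ y x, y ≠ x → u t y x = r t y x * φ t y / φ t x) :
    ∀ x, ∀ t ∈ Set.Icc (0:ℝ) 1,
      HasDerivAt (fun s => p s x)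
        (∑ y ∈ Finset.univ.erase x, u t x y * p t y
          - (∑ y ∈ Finset.univ.erase x, u t y x) * p t x) t := by
  intro x t ht
  have hfun : (fun s => p s x) = fun s => φ s x * φh s x := by
    funext s
    exact hpdef s x
  rw [hfun]
  have h := (hφ x t ht).mul (hφh x t ht)
  have h1 : ∑ y ∈ Finset.univ.erase x, u t x y * p t y
      = φ t x * ∑ y ∈ Finset.univ.erase x, r t x y * φh t y := by
    rw [Finset.mul_sum]
    refine Finset.sum_congr rfl fun y hy => ?_
    have hyx : y ≠ x := Finset.ne_of_mem_erase hy
    have hy0 := (hpos t ht y).ne'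
    rw [hu t x y hyx.symm, hpdef]
    field_simp
  have h2 : (∑ y ∈ Finset.univ.erase x, u t y x) * p t x
      = (∑ y ∈ Finset.univ.erase x, r t y x * φ t y) * φh t x := by
    rw [Finset.sum_mul, Finset.sum_mul]
    refine Finset.sum_congr rfl fun y hy => ?_
    have hyx : y ≠ x := Finset.ne_of_mem_erase hy
    have hx0 := (hpos t ht x).ne'
    rw [hu t y x hyx, hpdef]
    field_simp
  rw [h1, h2]
  refine h.congr_deriv ?_
  rw [← Finset.add_sum_erase Finset.univ (fun y => r t y x * φ t y) (Finset.mem_univ x),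
    ← Finset.add_sum_erase Finset.univ (fun y => r t x y * φh t y) (Finset.mem_univ x)]
  ring
end

section
/- Let 𝒳 be a finite nonempty set, let r : [0,1] × 𝒳 × 𝒳 → ℝ and f : [0,1] × 𝒳 → ℝ. Let φ, φ̂ : [0,1] × 𝒳 → ℝ be differentiable in t and satisfy ∂_t φ_t(x) = −∑_{y ∈ 𝒳} r_t(y,x)·φ_t(y) + f_t(x)·φ_t(x) and ∂_t φ̂_t(x) = ∑_{y ∈ 𝒳} r_t(x,y)·φ̂_t(y) − f_t(x)·φ̂_t(x) for all t ∈ [0,1] and x ∈ 𝒳. Then the total mass t ↦ ∑_{x ∈ 𝒳} φ_t(x)·φ̂_t(x) is constant on [0,1]. -/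
/-- If `(φ, φ̂)` solve the Schrödinger system on a graph, then the total mass
`t ↦ ∑ x, φ t x · φ̂ t x` is constant on `[0,1]`. -/
theorem stmt6 {𝒳 : Type*} [Fintype 𝒳] [Nonempty 𝒳]
    (r : ℝ → 𝒳 → 𝒳 → ℝ) (f : ℝ → 𝒳 → ℝ) (φ φh : ℝ → 𝒳 → ℝ)
    (hφ : ∀ x, ∀ t ∈ Set.Icc (0:ℝ) 1,
      HasDerivAt (fun s => φ s x)
        (-∑ y, r t y x * φ t y + f t x * φ t x) t)
    (hφh : ∀ x, ∀ t ∈ Set.Icc (0:ℝ) 1,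
      HasDerivAt (fun s => φh s x)
        (∑ y, r t x y * φh t y - f t x * φh t x) t) :
    ∀ t ∈ Set.Icc (0:ℝ) 1, ∀ t' ∈ Set.Icc (0:ℝ) 1,
      ∑ x, φ t x * φh t x = ∑ x, φ t' x * φh t' x := by
  have key : ∀ t ∈ Set.Icc (0:ℝ) 1,
      HasDerivAt (fun s => ∑ x, φ s x * φh s x) 0 t := by
    intro t ht
    have h := HasDerivAt.fun_sum (u := Finset.univ)
      (fun x _ => (hφ x t ht).fun_mul (hφh x t ht))
    refine h.congr_deriv ?_
    have e : ∀ x, (-∑ y, r t y x * φ t y + f t x * φ t x) * φh t x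
        + φ t x * (∑ y, r t x y * φh t y - f t x * φh t x)
        = ∑ y, φ t x * (r t x y * φh t y) - ∑ y, r t y x * φ t y * φh t x := by
      intro x
      rw [← Finset.mul_sum, ← Finset.sum_mul]
      ring
    rw [Finset.sum_congr rfl (fun x _ => e x), Finset.sum_sub_distrib, sub_eq_zero,
      Finset.sum_comm]
    refine Finset.sum_congr rfl fun x _ => Finset.sum_congr rfl fun y _ => ?_
    ring
  have c := constant_of_has_deriv_right_zero
    (fun t ht => (key t ht).continuousAt.continuousWithinAt)
    (fun t ht => (key t (Set.Ico_subset_Icc_self ht)).hasDerivWithinAt)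
  intro t ht t' ht'
  exact (c t ht).trans (c t' ht').symm
end

section
/- Let 𝒳 be a finite nonempty set, let r : [0,1] × 𝒳 × 𝒳 → ℝ and f : [0,1] × 𝒳 → ℝ, and let φ : [0,1] × 𝒳 → (0, ∞) be differentiable in t with ∂_t φ_t(x) = −∑_{y ∈ 𝒳} r_t(y,x)·φ_t(y) + f_t(x)·φ_t(x) for all t, x. Define Y_t(x) := log φ_t(x), Z_t(y,x) := Y_t(y) − Y_t(x), and the controlled rates u_t(y,x) := r_t(y,x)·exp(Z_t(y,x)). Then for all t ∈ [0,1] and x ∈ 𝒳, ∂_t Y_t(x) + ∑_{y ∈ 𝒳} ( Y_t(y) − Y_t(x) )·u_t(y,x) = f_t(x) + ∑_{y ∈ 𝒳} r_t(y,x)·exp(Z_t(y,x))·( Z_t(y,x) − 1 ). -/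
/-- Forward generator identity for `Y = log φ`:
`∂ₜ Y t x + ∑ y, (Y t y − Y t x)·u t y x
  = f t x + ∑ y, r t y x · exp (Z t y x) · (Z t y x − 1)`,
where `Z t y x = Y t y − Y t x` and `u t y x = r t y x · exp (Z t y x)`. -/
theorem stmt10 {𝒳 : Type*} [Fintype 𝒳] [Nonempty 𝒳]
    (r : ℝ → 𝒳 → 𝒳 → ℝ) (f : ℝ → 𝒳 → ℝ) (φ : ℝ → 𝒳 → ℝ)
    (hpos : ∀ t ∈ Set.Icc (0:ℝ) 1, ∀ x, 0 < φ t x)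
    (hφ : ∀ x, ∀ t ∈ Set.Icc (0:ℝ) 1,
      HasDerivAt (fun s => φ s x)
        (-∑ y, r t y x * φ t y + f t x * φ t x) t)
    (Y : ℝ → 𝒳 → ℝ) (hY : ∀ t x, Y t x = Real.log (φ t x))
    (Z : ℝ → 𝒳 → 𝒳 → ℝ) (hZ : ∀ t y x, Z t y x = Y t y - Y t x)
    (u : ℝ → 𝒳 → 𝒳 → ℝ) (hu : ∀ t y x, u t y x = r t y x * Real.exp (Z t y x)) :
    ∀ x, ∀ t ∈ Set.Icc (0:ℝ) 1,
      HasDerivAt (fun s => Y s x)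
        (f t x + ∑ y, r t y x * Real.exp (Z t y x) * (Z t y x - 1)
          - ∑ y, (Y t y - Y t x) * u t y x) t := by
  intro x t ht
  have hx := hpos t ht x
  have h := (hφ x t ht).log hx.ne'
  have hYx : (fun s => Y s x) = fun s => Real.log (φ s x) := funext fun s => hY s x
  have hexp : ∀ y, Real.exp (Z t y x) = φ t y / φ t x := by
    intro y
    rw [hZ, hY, hY, Real.exp_sub, Real.exp_log (hpos t ht y), Real.exp_log hx]
  rw [hYx]
  convert h using 1
  have key : ∑ y, r t y x * Real.exp (Z t y x) * (Z t y x - 1)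
      - ∑ y, (Y t y - Y t x) * u t y x = -((∑ y, r t y x * φ t y) / φ t x) := by
    rw [← Finset.sum_sub_distrib, Finset.sum_div, ← Finset.sum_neg_distrib]
    refine Finset.sum_congr rfl fun y _ => ?_
    rw [hu, ← hZ, hexp]
    ring
  rw [add_sub_assoc, key, add_div, mul_div_cancel_right₀ _ hx.ne', neg_div]
  ring
end

section
/- Let 𝒳 be a finite nonempty set, let r : [0,1] × 𝒳 × 𝒳 → ℝ and f : [0,1] × 𝒳 → ℝ, and let φ, φ̂ : [0,1] × 𝒳 → (0, ∞) be differentiable in t with ∂_t φ_t(x) = −∑_{y ∈ 𝒳} r_t(y,x)·φ_t(y) + f_t(x)·φ_t(x) and ∂_t φ̂_t(x) = ∑_{y ∈ 𝒳} r_t(x,y)·φ̂_t(y) − f_t(x)·φ̂_t(x) for all t, x. Define Y := log φ, Ŷ := log φ̂, Z_t(y,x) := Y_t(y) − Y_t(x), Ẑ_t(y,x) := Ŷ_t(y) − Ŷ_t(x), and u_t(y,x) := r_t(y,x)·exp(Z_t(y,x)). Then for all t ∈ [0,1] and x ∈ 𝒳, ∂_t (Y_t + Ŷ_t)(x) + ∑_{y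 ∈ 𝒳} [ (Y_t + Ŷ_t)(y) − (Y_t + Ŷ_t)(x) ]·u_t(y,x) = ∑_{y ∈ 𝒳} [ r_t(x,y)·exp(Ẑ_t(y,x)) + r_t(y,x)·exp(Z_t(y,x))·( Z_t(y,x) + Ẑ_t(y,x) − 1 ) ]; in particular the right-hand side does not depend on the running cost f. -/
/-- Generator applied to `log p = Y + Ŷ` along the forward controlled chain:
`∂ₜ (Y+Ŷ) t x + ∑ y, ((Y+Ŷ) t y − (Y+Ŷ) t x)·u t y x
  = ∑ y, (r t x y · exp (Ẑ t y x) + r t y x · exp (Z t y x)·(Z t y x + Ẑ t y x − 1))`;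
in particular the right-hand side does not depend on the running cost `f`. -/
theorem stmt12 {𝒳 : Type*} [Fintype 𝒳] [Nonempty 𝒳]
    (r : ℝ → 𝒳 → 𝒳 → ℝ) (f : ℝ → 𝒳 → ℝ) (φ φh : ℝ → 𝒳 → ℝ)
    (hposφ : ∀ t ∈ Set.Icc (0:ℝ) 1, ∀ x, 0 < φ t x)
    (hposφh : ∀ t ∈ Set.Icc (0:ℝ) 1, ∀ x, 0 < φh t x)
    (hφ : ∀ x, ∀ t ∈ Set.Icc (0:ℝ) 1,
      HasDerivAt (fun s => φ s x)
        (-∑ y, r t y x * φ t y + f t x * φ t x) t)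
    (hφh : ∀ x, ∀ t ∈ Set.Icc (0:ℝ) 1,
      HasDerivAt (fun s => φh s x)
        (∑ y, r t x y * φh t y - f t x * φh t x) t)
    (Y Yh : ℝ → 𝒳 → ℝ)
    (hY : ∀ t x, Y t x = Real.log (φ t x))
    (hYh : ∀ t x, Yh t x = Real.log (φh t x))
    (Z Zh : ℝ → 𝒳 → 𝒳 → ℝ)
    (hZ : ∀ t y x, Z t y x = Y t y - Y t x)
    (hZh : ∀ t y x, Zh t y x = Yh t y - Yh t x)
    (u : ℝ → 𝒳 → 𝒳 → ℝ) (hu : ∀ t y x, u t y x = r t y x * Real.exp (Z t y x)) :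
    ∀ x, ∀ t ∈ Set.Icc (0:ℝ) 1,
      HasDerivAt (fun s => Y s x + Yh s x)
        (∑ y, (r t x y * Real.exp (Zh t y x)
            + r t y x * Real.exp (Z t y x) * (Z t y x + Zh t y x - 1))
          - ∑ y, ((Y t y + Yh t y) - (Y t x + Yh t x)) * u t y x) t := by
  intro x t ht
  have p := hposφ t ht
  have q := hposφh t ht
  have h1 := ((hφ x t ht).log (p x).ne').add ((hφh x t ht).log (q x).ne')
  have hfun : (fun s => Y s x + Yh s x)
      = (fun s => Real.log (φ s x)) + (fun s => Real.log (φh s x)) := by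
    funext s
    simp [hY, hYh]
  rw [hfun]
  refine h1.congr_deriv ?_
  have eZ : ∀ y, Real.exp (Z t y x) = φ t y / φ t x := by
    intro y
    rw [hZ, hY, hY, Real.exp_sub, Real.exp_log (p y), Real.exp_log (p x)]
  have eZh : ∀ y, Real.exp (Zh t y x) = φh t y / φh t x := by
    intro y
    rw [hZh, hYh, hYh, Real.exp_sub, Real.exp_log (q y), Real.exp_log (q x)]
  have hR : ∑ y, (r t x y * Real.exp (Zh t y x)
            + r t y x * Real.exp (Z t y x) * (Z t y x + Zh t y x - 1))
          - ∑ y, ((Y t y + Yh t y) - (Y t x + Yh t x)) * u t y x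
      = (∑ y, r t x y * φh t y) / φh t x - (∑ y, r t y x * φ t y) / φ t x := by
    rw [Finset.sum_div, Finset.sum_div, ← Finset.sum_sub_distrib, ← Finset.sum_sub_distrib]
    refine Finset.sum_congr rfl fun y _ => ?_
    rw [hu, eZ, eZh, hZ, hZh]
    ring
  rw [hR]
  have hp := (p x).ne'
  have hq := (q x).ne'
  field_simp
  ring
end
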